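/- Let L'_7 be the lattice in ℝ³ generated by (−2,2,2), (3,−3,3), and (4,3,−1). Then there is no convex set T contained in the tetrahedron T_{3,10} which is a fundamental region for L'_7; that is, there is no convex T ⊆ T_{3,10} such that the translates {T + v : v ∈ L'_7} cover ℝ³ and any two distinct translates intersect in a set of Lebesgue measure zero. -/

import Mathlib

open MeasureTheory

lemma mem_L {y : Fin 3 → ℝ} (h : y ∈ AddSubgroup.closure
    ({![(-2 : ℝ), 2, 2], ![3, -3, 3], ![4, 3, -1]} : Set (Fin 3 → ℝ))) :
    ∃ a b c : ℤ, y = ![((-2*a+3*b+4*c : ℤ) : ℝ), ((2*a-3*b+3*c : ℤ) : ℝ),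
      ((2*a+3*b-c : ℤ) : ℝ)] := by
  induction h using AddSubgroup.closure_induction with
  | mem x hx =>
    rcases hx with rfl | rfl | rfl
    · exact ⟨1, 0, 0, by norm_num⟩
    · exact ⟨0, 1, 0, by norm_num⟩
    · exact ⟨0, 0, 1, by norm_num⟩
  | zero => exact ⟨0, 0, 0, by ext i; fin_cases i <;> simp⟩
  | add x y _ _ hx hy =>
    obtain ⟨a, b, c, rfl⟩ := hx
    obtain ⟨a', b', c', rfl⟩ := hy
    refine ⟨a + a', b + b', c + c', ?_⟩
    ext i; fin_cases i <;> simp <;> ring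
  | neg x _ hx =>
    obtain ⟨a, b, c, rfl⟩ := hx
    refine ⟨-a, -b, -c, ?_⟩
    ext i; fin_cases i <;> simp <;> ring

/-- A point whose only lattice translate in the simplex is itself lies in `T`. -/
lemma forced {T : Set (Fin 3 → ℝ)}
    (hT : T ⊆ {x : Fin 3 → ℝ | (∀ i, 0 ≤ x i) ∧ (∑ i, x i) ≤ 10})
    (hc : ∀ y : Fin 3 → ℝ, ∃ t ∈ T, y - t ∈ AddSubgroup.closure
        ({![(-2 : ℝ), 2, 2], ![3, -3, 3], ![4, 3, -1]} : Set (Fin 3 → ℝ)))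
    (m n k : ℤ)
    (H : ∀ a b c : ℤ, 4*(-2*a+3*b+4*c) ≤ m → 4*(2*a-3*b+3*c) ≤ n → 4*(2*a+3*b-c) ≤ k →
      m + n + k - 4*(2*a+3*b+6*c) ≤ 40 → a = 0 ∧ b = 0 ∧ c = 0) :
    ![(m:ℝ)/4, n/4, k/4] ∈ T := by
  obtain ⟨t, ht, h⟩ := hc ![(m:ℝ)/4, n/4, k/4]
  obtain ⟨a, b, c, h⟩ := mem_L h
  obtain ⟨hp, hs⟩ := hT ht
  rw [Fin.sum_univ_three] at hs
  have h0 := congrFun h 0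
  have h1 := congrFun h 1
  have h2 := congrFun h 2
  have p0 := hp 0
  have p1 := hp 1
  have p2 := hp 2
  simp at h0 h1 h2
  obtain ⟨rfl, rfl, rfl⟩ := H a b c
    (by have : (4*(-2*a+3*b+4*c) : ℝ) ≤ m := by linarith
        exact_mod_cast this)
    (by have : (4*(2*a-3*b+3*c) : ℝ) ≤ n := by linarith
        exact_mod_cast this)
    (by have : (4*(2*a+3*b-c) : ℝ) ≤ k := by linarith
        exact_mod_cast this)
    (by have : (m + n + k - 4*(2*a+3*b+6*c) : ℝ) ≤ 40 := by linarith
        exact_mod_cast this)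
  have : ![(m:ℝ)/4, n/4, k/4] = t := by
    ext i
    simp at h0 h1 h2
    fin_cases i <;> simp <;> linarith
  rw [this]; exact ht

/-- There is no convex fundamental region for the lattice `L'_7`
(generated by `(−2,2,2)`, `(3,−3,3)`, `(4,3,−1)`) contained in the tetrahedron
`T_{3,10}`: no convex `T ⊆ T_{3,10}` has translates by `L'_7` covering `ℝ³` with any
two distinct translates meeting in a set of Lebesgue measure zero. -/
theorem stmt18 :
    ¬ ∃ T : Set (Fin 3 → ℝ), Convex ℝ T ∧
      T ⊆ {x : Fin 3 → ℝ | (∀ i, 0 ≤ x i) ∧ (∑ i, x i) ≤ 10} ∧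
      (∀ y : Fin 3 → ℝ, ∃ t ∈ T, y - t ∈ AddSubgroup.closure
        ({![(-2 : ℝ), 2, 2], ![3, -3, 3], ![4, 3, -1]} : Set (Fin 3 → ℝ))) ∧
      (∀ v ∈ AddSubgroup.closure
          ({![(-2 : ℝ), 2, 2], ![3, -3, 3], ![4, 3, -1]} : Set (Fin 3 → ℝ)),
        ∀ w ∈ AddSubgroup.closure
          ({![(-2 : ℝ), 2, 2], ![3, -3, 3], ![4, 3, -1]} : Set (Fin 3 → ℝ)),
        v ≠ w →
          volume ({x : Fin 3 → ℝ | x - v ∈ T} ∩ {x : Fin 3 → ℝ | x - w ∈ T}) = 0) := by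
  rintro ⟨T, hconv, hT, hcov, hdis⟩
  have f0 : ![(3:ℝ)/4, 3/4, 3/4] ∈ T := by
    have := forced hT hcov 3 3 3 (by
      intro a b c h1 h2 h3 h4
      have c1 : -1 ≤ c := by omega
      have c2 : c ≤ 1 := by omega
      have b1 : -2 ≤ b := by omega
      have b2 : b ≤ 2 := by omega
      interval_cases c <;> interval_cases b <;> omega)
    simpa using this
  have f1 : ![(31:ℝ)/4, 3/4, 3/4] ∈ T := by
    have := forced hT hcov 31 3 3 (by
      intro a b c h1 h2 h3 h4
      have c1 : -1 ≤ c := by omega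
      have c2 : c ≤ 1 := by omega
      have b1 : -2 ≤ b := by omega
      have b2 : b ≤ 2 := by omega
      interval_cases c <;> interval_cases b <;> omega)
    simpa using this
  have f2 : ![(3:ℝ)/4, 31/4, 3/4] ∈ T := by
    have := forced hT hcov 3 31 3 (by
      intro a b c h1 h2 h3 h4
      have c1 : -1 ≤ c := by omega
      have c2 : c ≤ 1 := by omega
      have b1 : -2 ≤ b := by omega
      have b2 : b ≤ 2 := by omega
      interval_cases c <;> interval_cases b <;> omega)
    simpa using this
  have f3 : ![(3:ℝ)/4, 3/4, 31/4] ∈ T := by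
    have := forced hT hcov 3 3 31 (by
      intro a b c h1 h2 h3 h4
      have c1 : -1 ≤ c := by omega
      have c2 : c ≤ 1 := by omega
      have b1 : -2 ≤ b := by omega
      have b2 : b ≤ 2 := by omega
      interval_cases c <;> interval_cases b <;> omega)
    simpa using this
  have hp : ![(17:ℝ)/4, 3/4, 3/4] ∈ T := by
    convert hconv f0 f1 (a := 1/2) (b := 1/2) (by norm_num) (by norm_num) (by norm_num) using 1
    ext i; fin_cases i <;> norm_num
  have hq : ![(3:ℝ)/4, 17/4, 17/4] ∈ T := by
    convert hconv f2 f3 (a := 1/2) (b := 1/2) (by norm_num) (by norm_num) (by norm_num) using 1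
    ext i; fin_cases i <;> norm_num
  have hz := hdis ![(-2 : ℝ), 2, 2] (AddSubgroup.subset_closure (by simp)) 0
    (AddSubgroup.zero_mem _) (by intro h; have := congrFun h 0; norm_num at this)
  have hsub : AffineMap.homothety ![(3:ℝ)/4, 17/4, 17/4] (3/7 : ℝ) '' T ⊆
      {x : Fin 3 → ℝ | x - ![(-2 : ℝ), 2, 2] ∈ T} ∩ {x : Fin 3 → ℝ | x - 0 ∈ T} := by
    rintro _ ⟨x, hx, rfl⟩
    constructor
    · show _ ∈ T
      convert hconv hx hp (a := 3/7) (b := 4/7) (by norm_num) (by norm_num) (by norm_num) using 1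
      ext i; fin_cases i <;> simp [AffineMap.homothety_apply, Matrix.vecHead, Matrix.vecTail] <;> ring
    · show _ ∈ T
      convert hconv hx hq (a := 3/7) (b := 4/7) (by norm_num) (by norm_num) (by norm_num) using 1
      ext i; fin_cases i <;> simp [AffineMap.homothety_apply, Matrix.vecHead, Matrix.vecTail] <;> ring
  have h0 := measure_mono_null hsub hz
  rw [Measure.addHaar_image_homothety] at h0
  have hT0 : volume T = 0 := by
    rcases mul_eq_zero.1 h0 with h | h
    · exfalso
      rw [ENNReal.ofReal_eq_zero] at h
      have : (0:ℝ) < |(3/7 : ℝ) ^ Module.finrank ℝ (Fin 3 → ℝ)| := by positivity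
      linarith
    · exact h
  have hun : (Set.univ : Set (Fin 3 → ℝ)) ⊆ ⋃ z : ℤ × ℤ × ℤ,
      (fun x => x + -![((-2*z.1+3*z.2.1+4*z.2.2 : ℤ) : ℝ), ((2*z.1-3*z.2.1+3*z.2.2 : ℤ) : ℝ),
      ((2*z.1+3*z.2.1-z.2.2 : ℤ) : ℝ)]) ⁻¹' T := by
    intro y _
    obtain ⟨t, ht, h⟩ := hcov y
    obtain ⟨a, b, c, h⟩ := mem_L h
    refine Set.mem_iUnion.2 ⟨(a, b, c), ?_⟩
    show _ ∈ T
    rw [← h]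
    convert ht using 1
    simp
  have hu : volume (Set.univ : Set (Fin 3 → ℝ)) = 0 := by
    refine measure_mono_null hun (measure_iUnion_null fun z => ?_)
    rw [measure_preimage_add_right]
    exact hT0
  exact (NeZero.ne (volume : Measure (Fin 3 → ℝ))) (Measure.measure_univ_eq_zero.1 hu)
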